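/- Subject reduction fails for ⊢1: for pairwise distinct atomic types a, b, c, the term (λx⁰.x⁰x⁰)(y⁰z⁰) has typing ⟨(y⁰ : b→((a→c)⊓a), z⁰ : b) ⊢1 c⟩ and β-reduces to (y⁰z⁰)(y⁰z⁰), yet (y⁰z⁰)(y⁰z⁰) : ⟨(y⁰ : b→((a→c)⊓a), z⁰ : b) ⊢1 c⟩ is not derivable. -/

import Mathlib

/-! Common development: the indexed λI-calculus (the λI^ℕ-calculus), types with
expansion variables, the realisability semantics, and the typing systems ⊢1 and ⊢2. -/

/-- The set of variables 𝓥, split as the disjoint union of two denumerably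
infinite sets 𝓥₁ (`Sum.inl`) and 𝓥₂ (`Sum.inr`). -/
abbrev Vr : Type := ℕ ⊕ ℕ

/-- Raw terms of the λI^ℕ-calculus: every variable occurrence carries a degree. -/
inductive Trm : Type
  | var : Vr → ℕ → Trm
  | app : Trm → Trm → Trm
  | lam : Vr → ℕ → Trm → Trm
  deriving DecidableEq

namespace Trm

/-- Free indexed variables `FV M`. -/
def FV : Trm → Set (Vr × ℕ)
  | var x n => {(x, n)}
  | app M N => FV M ∪ FV N
  | lam x n M => FV M \ {(x, n)}

/-- Names that are λ-bound somewhere in the term. -/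
def BV : Trm → Set Vr
  | var _ _ => ∅
  | app M N => BV M ∪ BV N
  | lam x _ M => insert x (BV M)

/-- Degree `d(M)` of a term. -/
def deg : Trm → ℕ
  | var _ n => n
  | app M N => min (deg M) (deg N)
  | lam _ _ M => deg M

/-- Joinability `M ◇ N`: any variable free in both occurs with the same degree. -/
def Joinable (M N : Trm) : Prop :=
  ∀ x m n, (x, m) ∈ FV M → (x, n) ∈ FV N → m = n

/-- Membership in the set 𝓜 of terms (λI-condition and joinability at applications). -/
inductive InM : Trm → Prop
  | var (x : Vr) (n : ℕ) : InM (Trm.var x n)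
  | app {M N : Trm} : InM M → InM N → Joinable M N → InM (Trm.app M N)
  | lam {M : Trm} {x : Vr} {n : ℕ} : InM M → (x, n) ∈ FV M → InM (Trm.lam x n M)

/-- The good terms 𝕄: the degree of a function is never larger than that of
its argument. -/
inductive Good : Trm → Prop
  | var (x : Vr) (n : ℕ) : Good (Trm.var x n)
  | app {M N : Trm} : Good M → Good N → Joinable M N → deg M ≤ deg N →
      Good (Trm.app M N)
  | lam {M : Trm} {x : Vr} {n : ℕ} : Good M → (x, n) ∈ FV M → Good (Trm.lam x n M)

/-- Substitution of `N` for `x^n` (capture is excluded by side conditions on its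
uses, following the Barendregt convention). -/
def subst (x : Vr) (n : ℕ) (N : Trm) : Trm → Trm
  | var y m => if y = x ∧ m = n then N else var y m
  | app P Q => app (subst x n N P) (subst x n N Q)
  | lam y m P => if y = x ∧ m = n then lam y m P else lam y m (subst x n N P)

/-- `M⁺`: raise every degree index by one. -/
def lift : Trm → Trm
  | var x n => var x (n + 1)
  | app M N => app (lift M) (lift N)
  | lam x n M => lam x (n + 1) (lift M)

/-- One-step β-reduction `▷β`: the least compatible relation closed under the
rule `(λx^n.M)N ▷β M[x^n := N]` when `d(N) = n` (the λI-condition `x^n ∈ FV M`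
and the absence of capture come from working with terms of 𝓜 modulo α under
the Barendregt convention). -/
inductive Beta : Trm → Trm → Prop
  | redex {x : Vr} {n : ℕ} {M N : Trm} :
      (x, n) ∈ FV M → deg N = n →
      (∀ y m, (y, m) ∈ FV N → y ∉ BV M) →
      Beta (Trm.app (Trm.lam x n M) N) (subst x n N M)
  | lam {M N : Trm} {x : Vr} {n : ℕ} :
      Beta M N → (x, n) ∈ FV M → (x, n) ∈ FV N →
      Beta (Trm.lam x n M) (Trm.lam x n N)
  | appL {M N P : Trm} :
      Beta M N → Joinable M P → Joinable N P →
      Beta (Trm.app M P) (Trm.app N P)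
  | appR {M N P : Trm} :
      Beta M N → Joinable P M → Joinable P N →
      Beta (Trm.app P M) (Trm.app P N)

/-- `▷β*`: the reflexive transitive closure of `▷β`. -/
def Betas : Trm → Trm → Prop := Relation.ReflTransGen Beta

end Trm

/-- `𝕄ⁿ`: the good terms of degree `n`. -/
def Mdeg (n : ℕ) : Set Trm := {M | Trm.Good M ∧ Trm.deg M = n}

/-- A set of terms is saturated iff it is closed under β-expansion. -/
def Saturated (X : Set Trm) : Prop := ∀ M N, Trm.Betas M N → N ∈ X → M ∈ X

/-- `X ⤳ Y`. -/
def ArrSet (X Y : Set Trm) : Set Trm :=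
  {M | ∀ N ∈ X, Trm.Joinable M N → Trm.app M N ∈ Y}

/-- `𝓝ₓⁿ = {x^n N₁ … N_k ∈ 𝕄 ∣ k ≥ 0}` for `x ∈ 𝓥₁`. -/
def NSet (x n : ℕ) : Set Trm :=
  {M | Trm.Good M ∧ ∃ l : List Trm, M = l.foldl Trm.app (Trm.var (Sum.inl x) n)}

/-- Types over the denumerable set ℕ of atomic types and a set `E` of expansion
variables. -/
inductive Ty (E : Type) : Type
  | atom : ℕ → Ty E
  | arr : Ty E → Ty E → Ty E
  | inter : Ty E → Ty E → Ty E
  | exp : E → Ty E → Ty E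

namespace Ty

variable {E : Type}

/-- Degree `d(U)` of a type. -/
def deg : Ty E → ℕ
  | atom _ => 0
  | arr U T => min (deg U) (deg T)
  | inter U V => min (deg U) (deg V)
  | exp _ U => deg U + 1

/-- Good types. -/
inductive GoodTy : Ty E → Prop
  | atom (a : ℕ) : GoodTy (Ty.atom a)
  | exp {U : Ty E} (e : E) : GoodTy U → GoodTy (Ty.exp e U)
  | arr {U T : Ty E} : GoodTy U → GoodTy T → deg T ≤ deg U → GoodTy (Ty.arr U T)
  | inter {U V : Ty E} : GoodTy U → GoodTy V → deg U = deg V → GoodTy (Ty.inter U V)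

mutual
  /-- The restricted types 𝕋 (no arrow on the left of ⊓ or of an expansion). -/
  inductive IsT : Ty E → Prop
    | atom (a : ℕ) : IsT (Ty.atom a)
    | arr {U T : Ty E} : IsU U → IsT T → IsT (Ty.arr U T)
  /-- The restricted types 𝕌. -/
  inductive IsU : Ty E → Prop
    | ofT {T : Ty E} : IsT T → IsU T
    | inter {U V : Ty E} : IsU U → IsU V → IsU (Ty.inter U V)
    | exp {U : Ty E} (e : E) : IsU U → IsU (Ty.exp e U)
end

/-- Equality of types induced by the quotient (⊓ commutative, associative,
idempotent, and `e(U₁ ⊓ U₂) = eU₁ ⊓ eU₂`), as a congruence. -/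
inductive TEq : Ty E → Ty E → Prop
  | refl (U : Ty E) : TEq U U
  | symm {U V : Ty E} : TEq U V → TEq V U
  | trans {U V W : Ty E} : TEq U V → TEq V W → TEq U W
  | comm (U V : Ty E) : TEq (Ty.inter U V) (Ty.inter V U)
  | assoc (U V W : Ty E) : TEq (Ty.inter (Ty.inter U V) W) (Ty.inter U (Ty.inter V W))
  | idem (U : Ty E) : TEq (Ty.inter U U) U
  | dist (e : E) (U V : Ty E) :
      TEq (Ty.exp e (Ty.inter U V)) (Ty.inter (Ty.exp e U) (Ty.exp e V))
  | arrCongr {U U' T T' : Ty E} : TEq U U' → TEq T T' → TEq (Ty.arr U T) (Ty.arr U' T')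
  | interCongr {U U' V V' : Ty E} : TEq U U' → TEq V V' →
      TEq (Ty.inter U V) (Ty.inter U' V')
  | expCongr (e : E) {U U' : Ty E} : TEq U U' → TEq (Ty.exp e U) (Ty.exp e U')

/-- The degree-decreasing operation `U⁻` (meaningful when `d(U) > 0`). -/
def tmin : Ty E → Ty E
  | exp _ U => U
  | inter U V => inter (tmin U) (tmin V)
  | atom a => atom a
  | arr U T => arr U T

/-- The subtyping relation ⊑ on 𝕌.  It contains the quotient equality `TEq`,
which makes it reflexive on equivalence classes of types. -/
inductive TSub : Ty E → Ty E → Prop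
  | ofEq {U V : Ty E} : TEq U V → TSub U V
  | trans {U V W : Ty E} : TSub U V → TSub V W → TSub U W
  | interElim {U₁ U₂ : Ty E} : GoodTy U₂ → deg U₁ = deg U₂ →
      TSub (Ty.inter U₁ U₂) U₁
  | interCongr {U₁ U₂ V₁ V₂ : Ty E} : TSub U₁ V₁ → TSub U₂ V₂ →
      TSub (Ty.inter U₁ U₂) (Ty.inter V₁ V₂)
  | arr {U₁ U₂ T₁ T₂ : Ty E} : TSub U₂ U₁ → TSub T₁ T₂ →
      TSub (Ty.arr U₁ T₁) (Ty.arr U₂ T₂)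
  | expCongr (e : E) {U V : Ty E} : TSub U V → TSub (Ty.exp e U) (Ty.exp e V)

end Ty

/-- Type environments: finite maps from indexed variables to types. -/
abbrev Env (E : Type) : Type := Vr × ℕ → Option (Ty E)

namespace Env

variable {E : Type}

/-- The empty environment `()`. -/
def empty : Env E := fun _ => none

def dom (Γ : Env E) : Set (Vr × ℕ) := {p | Γ p ≠ none}

/-- The singleton environment `(x^n : U)`. -/
def single (p : Vr × ℕ) (U : Ty E) : Env E := fun q => if q = p then some U else none

/-- The extension `Γ, (x^n : U)`. -/
def update (Γ : Env E) (p : Vr × ℕ) (U : Ty E) : Env E :=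
  fun q => if q = p then some U else Γ q

/-- Joinability `Γ₁ ◇ Γ₂` of environments. -/
def Joinable (Γ₁ Γ₂ : Env E) : Prop :=
  ∀ x m n, (x, m) ∈ dom Γ₁ → (x, n) ∈ dom Γ₂ → m = n

/-- `Γ₁ ⊓ Γ₂`. -/
def inter (Γ₁ Γ₂ : Env E) : Env E := fun p =>
  match Γ₁ p, Γ₂ p with
  | some U, some V => some (Ty.inter U V)
  | some U, none => some U
  | none, o => o

/-- `eΓ`: apply `e` to every type of `Γ` and raise every variable index by one. -/
def eexp (e : E) (Γ : Env E) : Env E := fun p =>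
  match p with
  | (_, 0) => none
  | (x, n + 1) => (Γ (x, n)).map (Ty.exp e)

/-- A good environment. -/
def Good (Γ : Env E) : Prop := ∀ p U, Γ p = some U → Ty.GoodTy U

/-- Environments equal up to the quotient equality on types. -/
def EqT (Γ Γ' : Env E) : Prop :=
  (∀ p, Γ p = none ↔ Γ' p = none) ∧
  ∀ p U U', Γ p = some U → Γ' p = some U' → Ty.TEq U U'

/-- Pointwise subtyping of environments (with the same domain). -/
def LE (Γ Γ' : Env E) : Prop :=
  (∀ p, Γ p = none ↔ Γ' p = none) ∧
  ∀ p U U', Γ p = some U → Γ' p = some U' → Ty.TSub U U'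

end Env

/-- The typing system ⊢1 (types range over the full set 𝓣). -/
inductive Der1 {E : Type} : Trm → Env E → Ty E → Prop
  | ax (x : Vr) (n : ℕ) {T : Ty E} : Ty.GoodTy T → Ty.deg T = n →
      Der1 (Trm.var x n) (Env.single (x, n) T) T
  | arrI {Γ : Env E} {x : Vr} {n : ℕ} {M : Trm} {U T : Ty E} :
      Γ (x, n) = none → Der1 M (Env.update Γ (x, n) U) T →
      Der1 (Trm.lam x n M) Γ (Ty.arr U T)
  | arrE {Γ₁ Γ₂ : Env E} {M₁ M₂ : Trm} {U T : Ty E} :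
      Der1 M₁ Γ₁ (Ty.arr U T) → Der1 M₂ Γ₂ U → Env.Joinable Γ₁ Γ₂ →
      Der1 (Trm.app M₁ M₂) (Env.inter Γ₁ Γ₂) T
  | inter {Γ₁ Γ₂ : Env E} {M : Trm} {U₁ U₂ : Ty E} :
      Der1 M Γ₁ U₁ → Der1 M Γ₂ U₂ →
      Der1 M (Env.inter Γ₁ Γ₂) (Ty.inter U₁ U₂)
  | exp (e : E) {Γ : Env E} {M : Trm} {U : Ty E} :
      Der1 M Γ U → Der1 (Trm.lift M) (Env.eexp e Γ) (Ty.exp e U)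
  | eq {Γ Γ' : Env E} {M : Trm} {U U' : Ty E} :
      Der1 M Γ U → Env.EqT Γ Γ' → Ty.TEq U U' → Der1 M Γ' U'

/-- The typing system ⊢2 (types range over 𝕌, with `T` ranging over 𝕋),
with the subsumption rule for ⊑. -/
inductive Der2 {E : Type} : Trm → Env E → Ty E → Prop
  | ax (x : Vr) {T : Ty E} : Ty.IsT T → Ty.GoodTy T →
      Der2 (Trm.var x 0) (Env.single (x, 0) T) T
  | arrI {Γ : Env E} {x : Vr} {n : ℕ} {M : Trm} {U T : Ty E} :
      Ty.IsU U → Ty.IsT T →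
      Γ (x, n) = none → Der2 M (Env.update Γ (x, n) U) T →
      Der2 (Trm.lam x n M) Γ (Ty.arr U T)
  | arrE {Γ₁ Γ₂ : Env E} {M₁ M₂ : Trm} {U T : Ty E} :
      Ty.IsU U → Ty.IsT T →
      Der2 M₁ Γ₁ (Ty.arr U T) → Der2 M₂ Γ₂ U → Env.Joinable Γ₁ Γ₂ →
      Der2 (Trm.app M₁ M₂) (Env.inter Γ₁ Γ₂) T
  | inter {Γ₁ Γ₂ : Env E} {M : Trm} {U₁ U₂ : Ty E} :
      Der2 M Γ₁ U₁ → Der2 M Γ₂ U₂ →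
      Der2 M (Env.inter Γ₁ Γ₂) (Ty.inter U₁ U₂)
  | exp (e : E) {Γ : Env E} {M : Trm} {U : Ty E} :
      Der2 M Γ U → Der2 (Trm.lift M) (Env.eexp e Γ) (Ty.exp e U)
  | sub {Γ Γ' : Env E} {M : Trm} {U U' : Ty E} :
      Der2 M Γ U → Ty.TSub U U' → Env.LE Γ' Γ → Der2 M Γ' U'

/-- An interpretation `𝓘 : 𝓐 → 𝓟(𝓜⁰)`: each `𝓘(a)` is saturated and
`𝓝ₓ⁰ ⊆ 𝓘(a) ⊆ 𝕄⁰` for every `x ∈ 𝓥₁`. -/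
def IsInterp (I : ℕ → Set Trm) : Prop :=
  ∀ a : ℕ, Saturated (I a) ∧ (∀ x : ℕ, NSet x 0 ⊆ I a) ∧ I a ⊆ Mdeg 0

/-- The extension of an interpretation to all types:
`𝓘(eU) = 𝓘(U)⁺`, `𝓘(U ⊓ V) = 𝓘(U) ∩ 𝓘(V)`, `𝓘(U → T) = 𝓘(U) ⤳ 𝓘(T)`. -/
def IntExt {E : Type} (I : ℕ → Set Trm) : Ty E → Set Trm
  | Ty.atom a => I a
  | Ty.arr U T => ArrSet (IntExt I U) (IntExt I T)
  | Ty.inter U V => IntExt I U ∩ IntExt I V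
  | Ty.exp _ U => Trm.lift '' IntExt I U

/-- The meaning `[U]` of a type: the closed terms belonging to `𝓘(U)` for
every interpretation `𝓘`. -/
def Mean {E : Type} (U : Ty E) : Set Trm :=
  {M | Trm.InM M ∧ Trm.FV M = ∅ ∧ ∀ I : ℕ → Set Trm, IsInterp I → M ∈ IntExt I U}

/-- Simultaneous substitution along a finite assignment `σ`. -/
def msubst (σ : Vr × ℕ → Option Trm) : Trm → Trm
  | Trm.var x n => (σ (x, n)).getD (Trm.var x n)
  | Trm.app M N => Trm.app (msubst σ M) (msubst σ N)
  | Trm.lam x n M => Trm.lam x n (msubst (fun p => if p = (x, n) then none else σ p) M)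

/-- The simultaneous substitution `M[(xⱼ^{nⱼ} := Nⱼ)ⱼ]` is defined: the set
`{M} ∪ {Nⱼ ∣ j}` is pairwise joinable and (Barendregt convention) no capture occurs. -/
def SubstDefined (σ : Vr × ℕ → Option Trm) (M : Trm) : Prop :=
  (∀ p N, σ p = some N → Trm.Joinable M N) ∧
  (∀ p q N N', σ p = some N → σ q = some N' → Trm.Joinable N N') ∧
  (∀ p N y m, σ p = some N → (y, m) ∈ Trm.FV N → y ∉ Trm.BV M)

namespace Ty

variable {E : Type}

/-- A finite invariant of types modulo `TEq`: the kinds of the components of a type, where atoms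
have kind `0`, arrows into a type of kinds `{0, 1}` have kind `2`, and other arrows kind `1`. -/
def kinds : Ty E → Finset ℕ
  | atom _ => {0}
  | arr _ T => {if kinds T = {0, 1} then 2 else 1}
  | inter U V => kinds U ∪ kinds V
  | exp _ _ => {3}

theorem TEq.kinds_eq {U V : Ty E} (h : TEq U V) : kinds U = kinds V := by
  induction h with
  | refl => rfl
  | symm _ ih => exact ih.symm
  | trans _ _ ih₁ ih₂ => exact ih₁.trans ih₂
  | comm U V => exact Finset.union_comm _ _
  | assoc U V W => exact Finset.union_assoc _ _ _
  | idem U => exact Finset.union_self _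
  | dist e U V => rfl
  | arrCongr _ _ _ ih => simp only [kinds, ih]
  | interCongr _ _ ih₁ ih₂ => simp only [kinds, ih₁, ih₂]
  | expCongr => rfl

theorem kinds_arr_ne (U T : Ty E) : kinds (arr U T) ≠ {0, 1} := by
  simp only [kinds]
  split_ifs <;> decide

theorem kinds_eq_of_arr_subset {U T : Ty E} (h : kinds (arr U T) ⊆ {2}) :
    kinds T = {0, 1} := by
  by_contra hT
  simp [kinds, hT] at h

end Ty

namespace Env

variable {E : Type}

theorem EqT.exists_of_some {Γ Γ' : Env E} (h : EqT Γ Γ') {p : Vr × ℕ} {U : Ty E}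
    (hU : Γ p = some U) : ∃ U', Γ' p = some U' ∧ Ty.TEq U U' := by
  cases hU' : Γ' p with
  | none => simp [(h.1 p).2 hU'] at hU
  | some U' => exact ⟨U', rfl, h.2 p U U' hU hU'⟩

theorem inter_exists_of_some_left {Γ₁ : Env E} (Γ₂ : Env E) {p : Vr × ℕ} {U : Ty E}
    (hU : Γ₁ p = some U) :
    ∃ V, inter Γ₁ Γ₂ p = some V ∧ Ty.kinds U ⊆ Ty.kinds V := by
  cases h₂ : Γ₂ p with
  | none => exact ⟨U, by simp [inter, hU, h₂], subset_rfl⟩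
  | some W =>
    exact ⟨Ty.inter U W, by simp [inter, hU, h₂], Finset.subset_union_left⟩

end Env

namespace Der1

variable {E : Type}

theorem exists_teq_of_var {x : Vr} {Γ : Env E} {T : Ty E} (h : Der1 (Trm.var x 0) Γ T) :
    ∃ U, Γ (x, 0) = some U ∧ Ty.TEq U T := by
  generalize hM : Trm.var x 0 = M at h
  induction h with
  | ax x' n hT hd =>
    cases hM
    exact ⟨_, by simp [Env.single], .refl _⟩
  | arrI => cases hM
  | arrE => cases hM
  | inter _ _ ih₁ ih₂ =>
    obtain ⟨U₁, h₁, e₁⟩ := ih₁ hM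
    obtain ⟨U₂, h₂, e₂⟩ := ih₂ hM
    exact ⟨Ty.inter U₁ U₂, by simp [Env.inter, h₁, h₂], .interCongr e₁ e₂⟩
  | @exp e Γ M U _ _ => cases M <;> simp [Trm.lift] at hM
  | eq _ hΓ hU ih =>
    obtain ⟨U, h, e⟩ := ih hM
    obtain ⟨U', h', e'⟩ := hΓ.exists_of_some h
    exact ⟨U', h', (e'.symm.trans e).trans hU⟩

theorem kinds_of_var_app_var {y z : Vr} {Γ : Env E} {T : Ty E}
    (h : Der1 (Trm.app (Trm.var y 0) (Trm.var z 0)) Γ T) :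
    ∃ Y, Γ (y, 0) = some Y ∧ (Ty.kinds Y ⊆ {2} → Ty.kinds T = {0, 1}) := by
  generalize hM : Trm.app (Trm.var y 0) (Trm.var z 0) = M at h
  induction h with
  | ax => cases hM
  | arrI => cases hM
  | @arrE Γ₁ Γ₂ M₁ M₂ U T h₁ _ _ _ _ =>
    cases hM
    obtain ⟨Y, hY, e⟩ := h₁.exists_teq_of_var
    obtain ⟨V, hV, hs⟩ := Env.inter_exists_of_some_left Γ₂ hY
    exact ⟨V, hV, fun h => Ty.kinds_eq_of_arr_subset (e.kinds_eq ▸ hs.trans h)⟩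
  | inter _ _ ih₁ ih₂ =>
    obtain ⟨U₁, h₁, e₁⟩ := ih₁ hM
    obtain ⟨U₂, h₂, e₂⟩ := ih₂ hM
    refine ⟨Ty.inter U₁ U₂, by simp [Env.inter, h₁, h₂], fun h => ?_⟩
    simp only [Ty.kinds, e₁ (Finset.subset_union_left.trans h),
      e₂ (Finset.subset_union_right.trans h), Finset.union_self]
  | @exp e Γ M U _ _ =>
    rcases M with _ | ⟨_ | _ | _, _⟩ | _ <;> simp [Trm.lift] at hM
  | eq _ hΓ hU ih =>
    obtain ⟨U, h, e⟩ := ih hM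
    obtain ⟨U', h', e'⟩ := hΓ.exists_of_some h
    exact ⟨U', h', fun h => hU.kinds_eq ▸ e (e'.kinds_eq ▸ h)⟩

theorem not_kinds_of_var_app_var_app {y z : Vr} {Q : Trm} {Γ : Env E} {T : Ty E}
    (h : Der1 (Trm.app (Trm.app (Trm.var y 0) (Trm.var z 0)) Q) Γ T) :
    ∃ Y, Γ (y, 0) = some Y ∧ ¬ Ty.kinds Y ⊆ {2} := by
  generalize hM : Trm.app (Trm.app (Trm.var y 0) (Trm.var z 0)) Q = M at h
  induction h with
  | ax => cases hM
  | arrI => cases hM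
  | @arrE Γ₁ Γ₂ M₁ M₂ U T h₁ _ _ _ _ =>
    cases hM
    obtain ⟨Y, hY, e⟩ := h₁.kinds_of_var_app_var
    obtain ⟨V, hV, hs⟩ := Env.inter_exists_of_some_left Γ₂ hY
    exact ⟨V, hV, fun h => Ty.kinds_arr_ne U T (e (hs.trans h))⟩
  | @inter Γ₁ Γ₂ _ _ _ _ _ ih₁ _ =>
    obtain ⟨Y, hY, e⟩ := ih₁ hM
    obtain ⟨V, hV, hs⟩ := Env.inter_exists_of_some_left Γ₂ hY
    exact ⟨V, hV, fun h => e (hs.trans h)⟩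
  | @exp e Γ M U _ _ =>
    rcases M with _ | ⟨_ | ⟨_ | _ | _, _⟩ | _, _⟩ | _ <;> simp [Trm.lift] at hM
  | eq _ hΓ _ ih =>
    obtain ⟨U, h, e⟩ := ih hM
    obtain ⟨U', h', e'⟩ := hΓ.exists_of_some h
    exact ⟨U', h', e'.kinds_eq ▸ e⟩

theorem lam_app_self (a c : ℕ) (x : Vr) :
    Der1 (Trm.lam x 0 (Trm.app (Trm.var x 0) (Trm.var x 0))) (Env.empty : Env E)
      (Ty.arr (Ty.inter (Ty.arr (Ty.atom a) (Ty.atom c)) (Ty.atom a)) (Ty.atom c)) := by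
  refine .arrI rfl ?_
  have hΓ : Env.update (Env.empty : Env E) (x, 0)
      (Ty.inter (Ty.arr (Ty.atom a) (Ty.atom c)) (Ty.atom a)) =
      Env.inter (Env.single (x, 0) (Ty.arr (Ty.atom a) (Ty.atom c)))
        (Env.single (x, 0) (Ty.atom a)) := by
    funext p
    by_cases hp : p = (x, 0) <;> simp [Env.update, Env.empty, Env.inter, Env.single, hp]
  rw [hΓ]
  refine .arrE (.ax x 0 (.arr (.atom a) (.atom c) le_rfl) rfl) (.ax x 0 (.atom a) rfl) ?_
  intro v m n hm hn
  simp [Env.dom, Env.single] at hm hn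
  omega

theorem var_app_var {U T : Ty E} (hU : Ty.GoodTy U) (hT : Ty.GoodTy T) (hdU : Ty.deg U = 0)
    (hdT : Ty.deg T = 0) {y z : Vr} (hyz : y ≠ z) :
    Der1 (Trm.app (Trm.var y 0) (Trm.var z 0))
      (Env.update (Env.single (y, 0) (Ty.arr U T)) (z, 0) U) T := by
  have hΓ : Env.update (Env.single (y, 0) (Ty.arr U T)) (z, 0) U =
      Env.inter (Env.single (y, 0) (Ty.arr U T)) (Env.single (z, 0) U) := by
    funext p
    by_cases hy : p = (y, 0)
    · simp [Env.update, Env.inter, Env.single, hy, hyz]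
    · by_cases hz : p = (z, 0) <;>
        simp [Env.update, Env.inter, Env.single, hy, hz, hyz.symm]
  rw [hΓ]
  refine .arrE (.ax y 0 (.arr hU hT (by omega)) (by simp [Ty.deg, hdU])) (.ax z 0 hU hdU) ?_
  intro v m n hm hn
  simp [Env.dom, Env.single] at hm hn
  omega

end Der1

/-- subject reduction fails for ⊢1: for pairwise distinct atomic
types `a, b, c`, the term `(λx⁰.x⁰x⁰)(y⁰z⁰)` has the typing
`⟨(y⁰ : b→((a→c)⊓a), z⁰ : b) ⊢1 c⟩` and β-reduces to `(y⁰z⁰)(y⁰z⁰)`, yet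
`(y⁰z⁰)(y⁰z⁰) : ⟨(y⁰ : b→((a→c)⊓a), z⁰ : b) ⊢1 c⟩` is not derivable. -/
theorem subject_reduction_fails_der1 (a b c : ℕ) (hab : a ≠ b) (hac : a ≠ c)
    (hbc : b ≠ c) (x y z : Vr) (hxy : x ≠ y) (hxz : x ≠ z) (hyz : y ≠ z) :
    let Γ : Env ℕ :=
      Env.update
        (Env.single (y, 0)
          (Ty.arr (Ty.atom b) (Ty.inter (Ty.arr (Ty.atom a) (Ty.atom c)) (Ty.atom a))))
        (z, 0) (Ty.atom b)
    let M : Trm :=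
      Trm.app (Trm.lam x 0 (Trm.app (Trm.var x 0) (Trm.var x 0)))
        (Trm.app (Trm.var y 0) (Trm.var z 0))
    let N : Trm :=
      Trm.app (Trm.app (Trm.var y 0) (Trm.var z 0))
        (Trm.app (Trm.var y 0) (Trm.var z 0))
    Der1 M Γ (Ty.atom c) ∧ Trm.Beta M N ∧ ¬ Der1 N Γ (Ty.atom c) := by
  intro Γ M N
  refine ⟨?_, ?_, ?_⟩
  · have hΓ : Γ = Env.inter Env.empty Γ := rfl
    rw [hΓ]
    refine .arrE (Der1.lam_app_self a c x)
      (Der1.var_app_var (.atom b)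
        (.inter (.arr (.atom a) (.atom c) le_rfl) (.atom a) rfl) rfl rfl hyz) ?_
    intro v m n hm
    exact absurd rfl hm
  · have h : Trm.Beta M (Trm.subst x 0 (Trm.app (Trm.var y 0) (Trm.var z 0))
        (Trm.app (Trm.var x 0) (Trm.var x 0))) :=
      .redex (by simp [Trm.FV]) rfl (by simp [Trm.BV])
    simpa [Trm.subst] using h
  · intro h
    obtain ⟨Y, hY, hk⟩ := h.not_kinds_of_var_app_var_app
    simp only [Γ, Env.update, Env.single, Prod.mk.injEq, hyz, false_and, if_false, if_true,
      Option.some.injEq] at hY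
    subst hY
    have h₀ : ({0} : Finset ℕ) ≠ {0, 1} := by decide
    have h₁ : ({1} ∪ {0} : Finset ℕ) = {0, 1} := by decide
    exact hk (by simp only [Ty.kinds, h₀, h₁, if_false, if_true, subset_rfl])
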